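/- arXiv:1501.00659 — 10 statements merged into one kernel-verified Lean document; each statement's English description precedes it below -/
import Mathlib

section
/- Let f : ℝ → ℝ be continuously differentiable and suppose the map s ↦ f(s)/|s|³ is nondecreasing on ℝ∖{0}. Define F(s) = ∫₀^s f(τ) dτ. Then for every fixed s ∈ ℝ the function t ↦ f(ts)·(ts) − 4·F(ts) is nondecreasing on (0, ∞); in particular, f(ts)·(ts) − 4·F(ts) ≤ f(s)·s − 4·F(s) for all t ∈ (0, 1] and all s ∈ ℝ. -/
theorem key_aux (f : ℝ → ℝ) (hf : ContDiff ℝ 1 f)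
    (hf4 : ∀ s₁ s₂ : ℝ, s₁ ≠ 0 → s₂ ≠ 0 → s₁ ≤ s₂ → f s₁ / |s₁| ^ 3 ≤ f s₂ / |s₂| ^ 3)
    (u : ℝ) : 0 ≤ u * (u * deriv f u - 3 * f u) := by
  have hd : HasDerivAt f (deriv f u) u := (hf.differentiable (by norm_num) u).hasDerivAt
  rcases lt_trichotomy u 0 with hu | hu | hu
  · have hm : MonotoneOn (fun v => f v / (-v) ^ 3) (Set.Iio 0) := by
      intro a ha b hb hab
      have := hf4 a b (ne_of_lt ha) (ne_of_lt hb) hab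
      rwa [abs_of_neg ha, abs_of_neg hb] at this
    have h1 := hm.derivWithin_nonneg (x := u)
    rw [derivWithin_of_isOpen isOpen_Iio hu] at h1
    have h2 := hd.div ((hasDerivAt_neg u).pow 3) (by simp [hu.ne])
    have h3 : deriv (fun v => f v / (-v) ^ 3) u = _ := h2.deriv
    rw [h3] at h1
    have hp : 0 < (-u) ^ 3 := by have := neg_pos.2 hu; positivity
    rw [le_div_iff₀ (by simp only [Pi.pow_apply]; positivity)] at h1
    simp at h1
    have h4 : 0 ≤ (-u) * (u * (u * deriv f u - 3 * f u)) := by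
      ring_nf at h1 ⊢
      linarith
    exact nonneg_of_mul_nonneg_right h4 (neg_pos.2 hu)
  · simp [hu]
  · have hm : MonotoneOn (fun v => f v / v ^ 3) (Set.Ioi 0) := by
      intro a ha b hb hab
      have := hf4 a b (ne_of_gt ha) (ne_of_gt hb) hab
      rwa [abs_of_pos ha, abs_of_pos hb] at this
    have h1 := hm.derivWithin_nonneg (x := u)
    rw [derivWithin_of_isOpen isOpen_Ioi hu] at h1
    have h2 := hd.div ((hasDerivAt_id u).pow 3) (by simp [hu.ne'])
    have h3 : deriv (fun v => f v / v ^ 3) u = _ := h2.deriv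
    rw [h3] at h1
    have hp : 0 < u ^ 3 := by positivity
    rw [le_div_iff₀ (by simp only [Pi.pow_apply, id]; positivity)] at h1
    simp at h1
    have h4 : 0 ≤ u * (u * (u * deriv f u - 3 * f u)) := by
      ring_nf at h1 ⊢
      linarith
    exact nonneg_of_mul_nonneg_right h4 hu

/-- If `f` is `C¹` and `s ↦ f s / |s|^3` is nondecreasing on `ℝ \ {0}`, with
`F s = ∫₀^s f`, then for each fixed `s`, the map `t ↦ f(ts)·(ts) − 4·F(ts)` is
nondecreasing on `(0, ∞)`; in particular `f(ts)·(ts) − 4·F(ts) ≤ f(s)·s − 4·F(s)`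
for all `t ∈ (0,1]` and all `s`. -/
theorem stmt_1 (f F : ℝ → ℝ) (hf : ContDiff ℝ 1 f)
    (hF : ∀ s : ℝ, F s = ∫ τ in (0:ℝ)..s, f τ)
    (hf4 : ∀ s₁ s₂ : ℝ, s₁ ≠ 0 → s₂ ≠ 0 → s₁ ≤ s₂ → f s₁ / |s₁| ^ 3 ≤ f s₂ / |s₂| ^ 3) :
    (∀ s : ℝ, MonotoneOn (fun t : ℝ => f (t * s) * (t * s) - 4 * F (t * s)) (Set.Ioi 0)) ∧
    (∀ t ∈ Set.Ioc (0:ℝ) 1, ∀ s : ℝ,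
      f (t * s) * (t * s) - 4 * F (t * s) ≤ f s * s - 4 * F s) := by
  have hmain : ∀ s : ℝ,
      MonotoneOn (fun t : ℝ => f (t * s) * (t * s) - 4 * F (t * s)) (Set.Ioi 0) := by
    intro s
    have hFd : ∀ u, HasDerivAt F (f u) u := by
      intro u
      rw [show F = fun s => ∫ τ in (0:ℝ)..s, f τ from funext hF]
      exact hf.continuous.integral_hasStrictDerivAt 0 u |>.hasDerivAt
    have hd : ∀ t : ℝ, HasDerivAt (fun t : ℝ => f (t * s) * (t * s) - 4 * F (t * s))
        (s * ((t * s) * deriv f (t * s) - 3 * f (t * s))) t := by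
      intro t
      have hl : HasDerivAt (fun t : ℝ => t * s) s t := by
        simpa using (hasDerivAt_id t).mul_const s
      have hfd : HasDerivAt f (deriv f (t * s)) (t * s) :=
        (hf.differentiable (by norm_num) _).hasDerivAt
      have h1 : HasDerivAt (fun t : ℝ => f (t * s)) (deriv f (t * s) * s) t :=
        HasDerivAt.comp t hfd hl
      have h2 : HasDerivAt (fun t : ℝ => F (t * s)) (f (t * s) * s) t :=
        HasDerivAt.comp t (hFd (t * s)) hl
      refine ((h1.mul hl).sub (h2.const_mul 4)).congr_deriv ?_
      ring
    apply monotoneOn_of_deriv_nonneg (convex_Ioi 0)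
    · exact fun t _ => (hd t).continuousAt.continuousWithinAt
    · exact fun t _ => (hd t).differentiableAt.differentiableWithinAt
    · intro t ht
      rw [interior_Ioi] at ht
      rw [(hd t).deriv]
      have h := key_aux f hf hf4 (t * s)
      rw [mul_assoc t s] at h
      have := nonneg_of_mul_nonneg_right h ht
      simpa [mul_assoc] using this
  refine ⟨hmain, ?_⟩
  intro t ht s
  have := hmain s (Set.mem_Ioi.2 ht.1) (Set.mem_Ioi.2 one_pos) ht.2
  simpa using this
end

section
/- Let f : ℝ → ℝ be continuously differentiable such that f(s)/|s|³ → 0 as s → 0 and the map s ↦ f(s)/|s|³ is nondecreasing on ℝ∖{0}. Define F(s) = ∫₀^s f(τ) dτ. Then f(s)·s ≥ 0 and 0 ≤ F(s) ≤ (1/4)·f(s)·s for every s ∈ ℝ. -/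
lemma stmt_2_pos (f : ℝ → ℝ) (hf : Continuous f)
    (hf1 : Filter.Tendsto (fun s : ℝ => f s / |s| ^ 3) (nhdsWithin 0 (Set.Ioi 0)) (nhds 0))
    (hf4 : ∀ s₁ s₂ : ℝ, 0 < s₁ → s₁ ≤ s₂ → f s₁ / |s₁| ^ 3 ≤ f s₂ / |s₂| ^ 3)
    (s : ℝ) (hs : 0 < s) :
    0 ≤ f s * s ∧ 0 ≤ (∫ τ in (0:ℝ)..s, f τ) ∧ (∫ τ in (0:ℝ)..s, f τ) ≤ (1/4) * (f s * s) := by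
  have hnn : ∀ t : ℝ, 0 < t → 0 ≤ f t := by
    intro t ht
    have h : 0 ≤ f t / |t| ^ 3 := by
      refine le_of_tendsto hf1 ?_
      filter_upwards [Ioc_mem_nhdsGT ht] with x hx
      exact hf4 x t hx.1 hx.2
    have h3 : 0 < |t| ^ 3 := by positivity
    have := mul_nonneg h h3.le
    rwa [div_mul_cancel₀ _ h3.ne'] at this
  refine ⟨mul_nonneg (hnn s hs) hs.le, ?_, ?_⟩
  · rw [intervalIntegral.integral_of_le hs.le]
    exact MeasureTheory.setIntegral_nonneg measurableSet_Ioc fun x hx => hnn x hx.1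
  · have h : (∫ τ in (0:ℝ)..s, f τ) ≤ ∫ τ in (0:ℝ)..s, f s / s ^ 3 * τ ^ 3 := by
      refine intervalIntegral.integral_mono_on_of_le_Ioo hs.le (hf.intervalIntegrable _ _)
        ((by fun_prop : Continuous fun τ : ℝ => f s / s ^ 3 * τ ^ 3).intervalIntegrable _ _) ?_
      intro x hx
      have h := hf4 x s hx.1 hx.2.le
      have hx0 := hx.1
      rw [abs_of_pos hx0, abs_of_pos hs, div_le_iff₀ (by positivity)] at h
      exact h
    refine h.trans (le_of_eq ?_)
    rw [intervalIntegral.integral_const_mul, integral_pow]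
    field_simp
    norm_num

/-- Under (f1) and (f4), `f(s)·s ≥ 0` and `0 ≤ F(s) ≤ (1/4)·f(s)·s` for every `s`. -/
theorem stmt_2 (f F : ℝ → ℝ) (hf : ContDiff ℝ 1 f)
    (hF : ∀ s : ℝ, F s = ∫ τ in (0:ℝ)..s, f τ)
    (hf1 : Filter.Tendsto (fun s : ℝ => f s / |s| ^ 3) (nhdsWithin 0 {0}ᶜ) (nhds 0))
    (hf4 : ∀ s₁ s₂ : ℝ, s₁ ≠ 0 → s₂ ≠ 0 → s₁ ≤ s₂ → f s₁ / |s₁| ^ 3 ≤ f s₂ / |s₂| ^ 3) :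
    ∀ s : ℝ, 0 ≤ f s * s ∧ 0 ≤ F s ∧ F s ≤ (1/4) * (f s * s) := by
  intro s
  rw [hF]
  have hc := hf.continuous
  rcases lt_trichotomy s 0 with hs | hs | hs
  · have key := stmt_2_pos (fun x => -f (-x)) (by fun_prop) ?_ ?_ (-s) (by linarith)
    · have e : (∫ τ in (0:ℝ)..(-s), -f (-τ)) = ∫ τ in (0:ℝ)..s, f τ := by
        rw [intervalIntegral.integral_neg, intervalIntegral.integral_comp_neg (fun x => f x),
          neg_neg, neg_zero, ← intervalIntegral.integral_symm]
      rw [e] at key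
      simpa using key
    · have hneg : Filter.Tendsto (fun x : ℝ => -x) (nhdsWithin 0 (Set.Ioi 0))
          (nhdsWithin 0 {0}ᶜ) := by
        refine tendsto_nhdsWithin_iff.2 ⟨?_, ?_⟩
        · have : Filter.Tendsto (fun x : ℝ => -x) (nhds 0) (nhds 0) := by
            simpa using (continuous_neg (G := ℝ)).tendsto 0
          exact this.mono_left nhdsWithin_le_nhds
        · filter_upwards [self_mem_nhdsWithin] with x hx
          simpa using (ne_of_gt hx)
      have h := (hf1.comp hneg).neg
      simpa [Function.comp_def, neg_div] using h
    · intro a b ha hab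
      have h := hf4 (-b) (-a) (by linarith) (by linarith) (by linarith)
      rw [abs_neg, abs_neg] at h
      simp only [neg_div]
      linarith
  · subst hs
    simp
  · refine stmt_2_pos f hc (hf1.mono_left (nhdsWithin_mono _ fun x hx => ?_)) ?_ s hs
    · exact ne_of_gt hx
    · intro a b ha hab
      exact hf4 a b ha.ne' (by linarith) hab
end

section
/- Let α, β, A > 0 and let ψ : (0, ∞) → ℝ be continuously differentiable with ψ(t) ≥ 0 for all t > 0, ψ(t)/t² → 0 as t → 0⁺, ψ(t)/t⁴ → +∞ as t → +∞, and t·ψ'(t) ≥ 4·ψ(t) for all t > 0. Define g(t) = (1/A)·(ψ(t)/t² − t²β − α) for t > 0. Then there exists a unique t* > 0 with g(t*) = 0; moreover g(t) < 0 for 0 < t < t*, g(t) > 0 for t > t*, and g'(t) > 0 for all t ≥ t*. -/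
/-- Lemma 2.1 (auxiliary function `g`): under the stated hypotheses on `ψ`, the function
`g(t) = (1/A)(ψ(t)/t² − t²β − α)` has a unique zero `t* > 0`; moreover `g < 0` on `(0, t*)`,
`g > 0` on `(t*, ∞)`, and `g' > 0` on `[t*, ∞)`. -/
theorem stmt_5 (α β A : ℝ) (hα : 0 < α) (hβ : 0 < β) (hA : 0 < A)
    (ψ : ℝ → ℝ) (hψ : ContDiffOn ℝ 1 ψ (Set.Ioi 0))
    (hnn : ∀ t : ℝ, 0 < t → 0 ≤ ψ t)
    (h0 : Filter.Tendsto (fun t : ℝ => ψ t / t ^ 2) (nhdsWithin 0 (Set.Ioi 0)) (nhds 0))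
    (hinf : Filter.Tendsto (fun t : ℝ => ψ t / t ^ 4) Filter.atTop Filter.atTop)
    (hder : ∀ t : ℝ, 0 < t → 4 * ψ t ≤ t * deriv ψ t)
    (g : ℝ → ℝ) (hg : ∀ t : ℝ, g t = (1 / A) * (ψ t / t ^ 2 - t ^ 2 * β - α)) :
    ∃ tstar : ℝ, 0 < tstar ∧ g tstar = 0 ∧
      (∀ t : ℝ, 0 < t → t < tstar → g t < 0) ∧
      (∀ t : ℝ, tstar < t → 0 < g t) ∧
      (∀ t : ℝ, tstar ≤ t → 0 < deriv g t) ∧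
      (∀ t : ℝ, 0 < t → g t = 0 → t = tstar) := by
  have hd : ∀ t : ℝ, 0 < t → HasDerivAt ψ (deriv ψ t) t := fun t ht =>
    ((hψ.differentiableOn (by norm_num)).differentiableAt (Ioi_mem_nhds ht)).hasDerivAt
  set h : ℝ → ℝ := fun t => ψ t / t ^ 4 - α / t ^ 2 - β with hh
  have hgh : ∀ t : ℝ, 0 < t → g t = (t ^ 2 / A) * h t := by
    intro t ht
    rw [hg]
    simp only [hh]
    field_simp
    ring
  have hhd : ∀ t : ℝ, 0 < t → HasDerivAt h ((t * deriv ψ t - 4 * ψ t) / t ^ 5 + 2 * α / t ^ 3) t := by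
    intro t ht
    have h1 := (((hd t ht).div (hasDerivAt_pow 4 t) (by positivity)).sub
      ((hasDerivAt_const t α).div (hasDerivAt_pow 2 t) (by positivity))).sub_const β
    refine h1.congr_deriv ?_
    field_simp
    push_cast
    ring
  have hmono : StrictMonoOn h (Set.Ioi 0) := by
    apply strictMonoOn_of_deriv_pos (convex_Ioi 0)
    · exact fun t ht => (hhd t ht).continuousAt.continuousWithinAt
    · intro t ht
      rw [interior_Ioi] at ht
      have ht' : 0 < t := ht
      rw [(hhd t ht').deriv]
      have h1 : 0 ≤ t * deriv ψ t - 4 * ψ t := by linarith [hder t ht']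
      positivity
  have hsmall : ∃ a : ℝ, 0 < a ∧ h a < 0 := by
    obtain ⟨a, ha1, ha2⟩ := ((h0.eventually (gt_mem_nhds hα)).and self_mem_nhdsWithin).exists
    have ha : 0 < a := ha2
    refine ⟨a, ha, ?_⟩
    have e : h a = (ψ a / a ^ 2 - α) / a ^ 2 - β := by
      simp only [hh]
      field_simp
    have : (ψ a / a ^ 2 - α) / a ^ 2 < 0 := div_neg_of_neg_of_pos (by linarith) (by positivity)
    linarith
  obtain ⟨a, ha, hha⟩ := hsmall
  have hbig : ∃ b : ℝ, a ≤ b ∧ 0 < h b := by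
    obtain ⟨b, ⟨hb1, hb2⟩, hb3⟩ := (((hinf.eventually_gt_atTop (α + β)).and
      (Filter.eventually_ge_atTop a)).and (Filter.eventually_ge_atTop 1)).exists
    refine ⟨b, hb2, ?_⟩
    have : α / b ^ 2 ≤ α := div_le_self hα.le (by nlinarith)
    simp only [hh]
    linarith
  obtain ⟨b, hab, hhb⟩ := hbig
  have hcont : ContinuousOn h (Set.Icc a b) := fun t ht =>
    (hhd t (lt_of_lt_of_le ha ht.1)).continuousAt.continuousWithinAt
  obtain ⟨c, hc, hc0⟩ := intermediate_value_Icc hab hcont ⟨hha.le, hhb.le⟩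
  have hcp : 0 < c := lt_of_lt_of_le ha hc.1
  have hneg : ∀ t : ℝ, 0 < t → t < c → g t < 0 := by
    intro t ht htc
    rw [hgh t ht]
    have := hmono (Set.mem_Ioi.2 ht) (Set.mem_Ioi.2 hcp) htc
    exact mul_neg_of_pos_of_neg (by positivity) (by linarith)
  have hpos : ∀ t : ℝ, c < t → 0 < g t := by
    intro t htc
    have ht : 0 < t := hcp.trans htc
    rw [hgh t ht]
    have := hmono (Set.mem_Ioi.2 hcp) (Set.mem_Ioi.2 ht) htc
    exact mul_pos (by positivity) (by linarith)
  refine ⟨c, hcp, by rw [hgh c hcp, hc0, mul_zero], hneg, hpos, ?_, ?_⟩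
  · intro t htc
    have ht : 0 < t := lt_of_lt_of_le hcp htc
    have hht : 0 ≤ h t := hc0 ▸ hmono.monotoneOn (Set.mem_Ioi.2 hcp) (Set.mem_Ioi.2 ht) htc
    have h2 := ((hasDerivAt_pow 2 t).div_const A).mul (hhd t ht)
    have h3 : HasDerivAt g _ t := h2.congr_of_eventuallyEq
      (Filter.eventuallyEq_of_mem (Ioi_mem_nhds ht) (fun s hs => hgh s hs))
    rw [h3.deriv]
    have h1 : 0 ≤ t * deriv ψ t - 4 * ψ t := by linarith [hder t ht]
    positivity
  · intro t ht h1
    rcases lt_trichotomy t c with h2 | h2 | h2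
    · linarith [hneg t ht h2]
    · exact h2
    · linarith [hpos t h2]
end

section
/- Let α₁, α₂, β₁, β₂, A > 0 and let ψ₁, ψ₂ : (0, ∞) → ℝ be continuously differentiable functions such that for i = 1, 2: ψᵢ(t) ≥ 0 for all t > 0, ψᵢ(t)/t² → 0 as t → 0⁺, ψᵢ(t)/t⁴ → +∞ as t → +∞, and t·ψᵢ'(t) ≥ 4·ψᵢ(t) for all t > 0. Then there exists a pair (t, s) ∈ (0, ∞) × (0, ∞) satisfying the system t²α₁ + t⁴β₁ + t²s²A = ψ₁(t) and s²α₂ + s⁴β₂ + t²s²A = ψ₂(s). -/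
lemma core_aux (A : ℝ) (hA : 0 < A) (H K : ℝ → ℝ) (hH : Continuous H) (hK : Continuous K)
    (hH0 : H 0 < 0) (hK0 : K 0 < 0)
    (hHi : ∃ N : ℝ, 0 < N ∧ ∀ t, N ≤ t → (A + 1) * t ^ 2 ≤ H t)
    (hKi : ∃ N : ℝ, 0 < N ∧ ∀ t, N ≤ t → (A + 1) * t ^ 2 ≤ K t) :
    ∃ t s : ℝ, 0 < t ∧ 0 < s ∧ H t = A * s ^ 2 ∧ K s = A * t ^ 2 := by
  obtain ⟨N, hN, hHN⟩ := hHi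
  obtain ⟨M, hM, hKM⟩ := hKi
  have hcomp : IsCompact (Set.Icc 0 N ∩ {t | H t ≤ 0}) :=
    isCompact_Icc.inter_right (isClosed_le hH continuous_const)
  obtain ⟨t₀, ⟨⟨ht₀0, ht₀N⟩, ht₀H⟩, hmax⟩ :=
    hcomp.exists_isGreatest ⟨0, ⟨le_refl _, hN.le⟩, hH0.le⟩
  simp only [Set.mem_setOf_eq] at ht₀H
  have hpos : ∀ t, t₀ < t → 0 < H t := by
    intro t ht
    by_contra hc
    push Not at hc
    rcases le_or_gt t N with h | h
    · exact absurd (hmax ⟨⟨ht₀0.trans ht.le, h⟩, hc⟩) (not_le.mpr ht)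
    · have h1 := hHN t h.le
      have : 0 < (A + 1) * t ^ 2 := by
        have : 0 < t := hN.trans h
        positivity
      linarith
  let F : ℝ → ℝ := fun t => K (Real.sqrt (H t / A)) - A * t ^ 2
  have hF : Continuous F := by
    have : Continuous fun t => Real.sqrt (H t / A) := (hH.div_const A).sqrt
    exact (hK.comp this).sub (by fun_prop)
  have hF0 : F t₀ < 0 := by
    have : Real.sqrt (H t₀ / A) = 0 :=
      Real.sqrt_eq_zero_of_nonpos (div_nonpos_of_nonpos_of_nonneg ht₀H hA.le)
    simp only [F, this]
    nlinarith [sq_nonneg t₀]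
  let T := max N M
  have hTN : N ≤ T := le_max_left _ _
  have hTM : M ≤ T := le_max_right _ _
  have hT : 0 < T := hN.trans_le hTN
  have hFT : 0 < F T := by
    have h1 := hHN T hTN
    have h2 : T ^ 2 ≤ H T / A := by
      rw [le_div_iff₀ hA]
      nlinarith [sq_nonneg T]
    have h3 : T ≤ Real.sqrt (H T / A) := Real.le_sqrt_of_sq_le h2
    have h4 := hKM _ (hTM.trans h3)
    have h5 : T ^ 2 ≤ Real.sqrt (H T / A) ^ 2 := by gcongr
    simp only [F]
    have h6 : 0 < T ^ 2 := by positivity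
    nlinarith
  obtain ⟨t, ⟨ht1, ht2⟩, htF⟩ :=
    intermediate_value_Icc (ht₀N.trans hTN) hF.continuousOn ⟨hF0.le, hFT.le⟩
  have htne : t₀ ≠ t := by
    rintro rfl
    linarith
  have htlt : t₀ < t := lt_of_le_of_ne ht1 htne
  have hHt := hpos t htlt
  have hq : 0 < H t / A := div_pos hHt hA
  refine ⟨t, Real.sqrt (H t / A), ht₀0.trans_lt htlt, Real.sqrt_pos.mpr hq, ?_, ?_⟩
  · rw [Real.sq_sqrt hq.le]
    field_simp
  · simp only [F] at htF
    linarith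

lemma ext_aux (α β A : ℝ) (hα : 0 < α) (ψ : ℝ → ℝ)
    (hψ : ContDiffOn ℝ 1 ψ (Set.Ioi 0))
    (h0 : Filter.Tendsto (fun t : ℝ => ψ t / t ^ 2) (nhdsWithin 0 (Set.Ioi 0)) (nhds 0))
    (hinf : Filter.Tendsto (fun t : ℝ => ψ t / t ^ 4) Filter.atTop Filter.atTop) :
    ∃ H : ℝ → ℝ, Continuous H ∧ H 0 < 0 ∧
      (∃ N : ℝ, 0 < N ∧ ∀ t, N ≤ t → (A + 1) * t ^ 2 ≤ H t) ∧
      ∀ t, 0 < t → H t = ψ t / t ^ 2 - β * t ^ 2 - α := by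
  classical
  let p : ℝ → ℝ := fun t => if t ≤ 0 then 0 else ψ t / t ^ 2
  have hpp : ∀ t, 0 < t → p t = ψ t / t ^ 2 := fun t ht => if_neg (not_le.mpr ht)
  have hpn : ∀ t, t ≤ 0 → p t = 0 := fun t ht => if_pos ht
  have hp : Continuous p := by
    rw [continuous_iff_continuousAt]
    intro x
    rcases lt_trichotomy x 0 with h | h | h
    · have : p =ᶠ[nhds x] fun _ => 0 := by
        filter_upwards [Iio_mem_nhds h] with y hy using hpn y (le_of_lt hy)
      exact continuousAt_const.congr this.symm
    · subst h
      rw [continuousAt_iff_continuous_left'_right']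
      constructor
      · refine (continuousWithinAt_const (b := (0 : ℝ))).congr ?_ (hpn 0 le_rfl)
        intro y hy
        exact hpn y (le_of_lt hy)
      · unfold ContinuousWithinAt
        rw [hpn 0 le_rfl]
        refine h0.congr' ?_
        filter_upwards [self_mem_nhdsWithin] with y hy using (hpp y hy).symm
    · have : p =ᶠ[nhds x] fun t => ψ t / t ^ 2 := by
        filter_upwards [Ioi_mem_nhds h] with y hy using hpp y hy
      refine ContinuousAt.congr ?_ this.symm
      exact (hψ.continuousOn.continuousAt (Ioi_mem_nhds h)).div (by fun_prop) (by positivity)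
  refine ⟨fun t => p t - β * t ^ 2 - α, by fun_prop, ?_, ?_, ?_⟩
  · simp [hpn 0 le_rfl, hα]
  · obtain ⟨N, hN⟩ := Filter.eventually_atTop.mp (hinf.eventually_ge_atTop (A + 1 + β + α))
    refine ⟨max N 1, by positivity, fun t ht => ?_⟩
    have h1 : 1 ≤ t := (le_max_right _ _).trans ht
    have ht0 : 0 < t := by linarith
    have h2 := hN t ((le_max_left _ _).trans ht)
    have h3 : ψ t / t ^ 2 = ψ t / t ^ 4 * t ^ 2 := by field_simp
    have h4 : (1 : ℝ) ≤ t ^ 2 := one_le_pow₀ h1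
    have h5 := mul_le_mul_of_nonneg_right h2 (sq_nonneg t)
    simp only [hpp t ht0, h3]
    nlinarith
  · intro t ht
    simp only [hpp t ht]


/-- Lemma 2.1 (existence): the Nehari-type system (2.3) has a solution `(t, s)` with
`t, s > 0`. -/
theorem stmt_6 (α₁ α₂ β₁ β₂ A : ℝ)
    (hα₁ : 0 < α₁) (hα₂ : 0 < α₂) (hβ₁ : 0 < β₁) (hβ₂ : 0 < β₂) (hA : 0 < A)
    (ψ₁ ψ₂ : ℝ → ℝ)
    (hψ₁ : ContDiffOn ℝ 1 ψ₁ (Set.Ioi 0)) (hψ₂ : ContDiffOn ℝ 1 ψ₂ (Set.Ioi 0))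
    (hnn₁ : ∀ t : ℝ, 0 < t → 0 ≤ ψ₁ t) (hnn₂ : ∀ t : ℝ, 0 < t → 0 ≤ ψ₂ t)
    (h0₁ : Filter.Tendsto (fun t : ℝ => ψ₁ t / t ^ 2) (nhdsWithin 0 (Set.Ioi 0)) (nhds 0))
    (h0₂ : Filter.Tendsto (fun t : ℝ => ψ₂ t / t ^ 2) (nhdsWithin 0 (Set.Ioi 0)) (nhds 0))
    (hinf₁ : Filter.Tendsto (fun t : ℝ => ψ₁ t / t ^ 4) Filter.atTop Filter.atTop)
    (hinf₂ : Filter.Tendsto (fun t : ℝ => ψ₂ t / t ^ 4) Filter.atTop Filter.atTop)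
    (hder₁ : ∀ t : ℝ, 0 < t → 4 * ψ₁ t ≤ t * deriv ψ₁ t)
    (hder₂ : ∀ t : ℝ, 0 < t → 4 * ψ₂ t ≤ t * deriv ψ₂ t) :
    ∃ t s : ℝ, 0 < t ∧ 0 < s ∧
      t ^ 2 * α₁ + t ^ 4 * β₁ + t ^ 2 * s ^ 2 * A = ψ₁ t ∧
      s ^ 2 * α₂ + s ^ 4 * β₂ + t ^ 2 * s ^ 2 * A = ψ₂ s := by
  obtain ⟨H, hH, hH0, hHi, hHe⟩ := ext_aux α₁ β₁ A hα₁ ψ₁ hψ₁ h0₁ hinf₁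
  obtain ⟨K, hK, hK0, hKi, hKe⟩ := ext_aux α₂ β₂ A hα₂ ψ₂ hψ₂ h0₂ hinf₂
  obtain ⟨t, s, ht, hs, h1, h2⟩ := core_aux A hA H K hH hK hH0 hK0 hHi hKi
  refine ⟨t, s, ht, hs, ?_, ?_⟩
  · rw [hHe t ht] at h1
    have h3 : ψ₁ t / t ^ 2 = α₁ + β₁ * t ^ 2 + A * s ^ 2 := by linarith
    rw [div_eq_iff (by positivity)] at h3
    rw [h3]; ring
  · rw [hKe s hs] at h2
    have h3 : ψ₂ s / s ^ 2 = α₂ + β₂ * s ^ 2 + A * t ^ 2 := by linarith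
    rw [div_eq_iff (by positivity)] at h3
    rw [h3]; ring
end

section
/- Let α₁, α₂, β₁, β₂, A > 0 and let ψ₁, ψ₂ : (0, ∞) → ℝ be functions such that t ↦ ψᵢ(t)/t⁴ is nondecreasing on (0, ∞) for i = 1, 2. Suppose ψ₁(1) > α₁ + β₁ + A and ψ₂(1) > α₂ + β₂ + A. If (t, s) ∈ (0, ∞) × (0, ∞) satisfies t²α₁ + t⁴β₁ + t²s²A = ψ₁(t) and s²α₂ + s⁴β₂ + t²s²A = ψ₂(s), then 0 < t < 1 and 0 < s < 1. -/
theorem stmt_7_aux (a b A : ℝ) (ha : 0 < a) (hA : 0 < A) (ψ : ℝ → ℝ)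
    (hm : MonotoneOn (fun t : ℝ => ψ t / t ^ 4) (Set.Ioi 0))
    (h : a + b + A < ψ 1) (t s : ℝ) (ht : 0 < t) (hs : 0 < s) (hst : s ≤ t)
    (heq : t ^ 2 * a + t ^ 4 * b + t ^ 2 * s ^ 2 * A = ψ t) : t < 1 := by
  by_contra hc
  have h1 : 1 ≤ t := not_lt.mp hc
  have h2 := hm (Set.mem_Ioi.mpr one_pos) (Set.mem_Ioi.mpr ht) h1
  have ht4 : 0 < t ^ 4 := by positivity
  simp only [one_pow, div_one] at h2
  rw [le_div_iff₀ ht4] at h2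
  have h3 : (a + b + A) * t ^ 4 < ψ 1 * t ^ 4 := mul_lt_mul_of_pos_right h ht4
  have h4 : t ^ 2 * a ≤ t ^ 4 * a :=
    mul_le_mul_of_nonneg_right (pow_le_pow_right₀ h1 (by norm_num)) ha.le
  have h5 : s ^ 2 ≤ t ^ 2 := pow_le_pow_left₀ hs.le hst 2
  have h6 : t ^ 2 * s ^ 2 * A ≤ t ^ 2 * t ^ 2 * A := by gcongr
  have h7 : t ^ 2 * t ^ 2 * A = t ^ 4 * A := by ring
  linarith

/-- Lemma 2.2 (1): if `ψᵢ(1) > αᵢ + βᵢ + A` and each `ψᵢ(t)/t⁴` is nondecreasing on `(0,∞)`,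
then any positive solution `(t, s)` of the system (2.3) satisfies `t < 1` and `s < 1`. -/
theorem stmt_7 (α₁ α₂ β₁ β₂ A : ℝ)
    (hα₁ : 0 < α₁) (hα₂ : 0 < α₂) (hβ₁ : 0 < β₁) (hβ₂ : 0 < β₂) (hA : 0 < A)
    (ψ₁ ψ₂ : ℝ → ℝ)
    (hmono₁ : MonotoneOn (fun t : ℝ => ψ₁ t / t ^ 4) (Set.Ioi 0))
    (hmono₂ : MonotoneOn (fun t : ℝ => ψ₂ t / t ^ 4) (Set.Ioi 0))
    (h₁ : α₁ + β₁ + A < ψ₁ 1) (h₂ : α₂ + β₂ + A < ψ₂ 1)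
    (t s : ℝ) (ht : 0 < t) (hs : 0 < s)
    (heq₁ : t ^ 2 * α₁ + t ^ 4 * β₁ + t ^ 2 * s ^ 2 * A = ψ₁ t)
    (heq₂ : s ^ 2 * α₂ + s ^ 4 * β₂ + t ^ 2 * s ^ 2 * A = ψ₂ s) :
    t < 1 ∧ s < 1 := by
  rcases le_total s t with h | h
  · have := stmt_7_aux α₁ β₁ A hα₁ hA ψ₁ hmono₁ h₁ t s ht hs h heq₁
    exact ⟨this, h.trans_lt this⟩
  · have := stmt_7_aux α₂ β₂ A hα₂ hA ψ₂ hmono₂ h₂ s t hs ht h (by linarith)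
    exact ⟨h.trans_lt this, this⟩
end

section
/- Let α₁, α₂, β₁, β₂, A > 0 and let ψ₁, ψ₂ : (0, ∞) → ℝ be functions such that t ↦ ψᵢ(t)/t⁴ is nondecreasing on (0, ∞) for i = 1, 2. Suppose ψ₁(1) < α₁ + β₁ + A and ψ₂(1) < α₂ + β₂ + A. If (t, s) ∈ (0, ∞) × (0, ∞) satisfies t²α₁ + t⁴β₁ + t²s²A = ψ₁(t) and s²α₂ + s⁴β₂ + t²s²A = ψ₂(s), then t > 1 and s > 1. -/
theorem stmt_8_aux (α β A : ℝ) (hα : 0 < α) (hA : 0 < A) (ψ : ℝ → ℝ)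
    (hmono : MonotoneOn (fun t : ℝ => ψ t / t ^ 4) (Set.Ioi 0))
    (h : ψ 1 < α + β + A) (t s : ℝ) (ht : 0 < t) (hts : t ≤ s)
    (heq : t ^ 2 * α + t ^ 4 * β + t ^ 2 * s ^ 2 * A = ψ t) : 1 < t := by
  by_contra hle
  have hle : t ≤ 1 := not_lt.mp hle
  have hm := hmono (Set.mem_Ioi.mpr ht) (Set.mem_Ioi.mpr one_pos) hle
  have h4 : 0 < t ^ 4 := by positivity
  simp only [one_pow, div_one] at hm
  rw [div_le_iff₀ h4] at hm
  have e1 : t ^ 4 * α ≤ t ^ 2 * α :=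
    mul_le_mul_of_nonneg_right (pow_le_pow_of_le_one ht.le hle (by norm_num)) hα.le
  have e2 : t ^ 2 * t ^ 2 * A ≤ t ^ 2 * s ^ 2 * A := by gcongr
  have e3 : ψ 1 * t ^ 4 < (α + β + A) * t ^ 4 := mul_lt_mul_of_pos_right h h4
  linarith

/-- Lemma 2.2 (2): if `ψᵢ(1) < αᵢ + βᵢ + A` and each `ψᵢ(t)/t⁴` is nondecreasing on `(0,∞)`,
then any positive solution `(t, s)` of the system (2.3) satisfies `t > 1` and `s > 1`. -/
theorem stmt_8 (α₁ α₂ β₁ β₂ A : ℝ)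
    (hα₁ : 0 < α₁) (hα₂ : 0 < α₂) (hβ₁ : 0 < β₁) (hβ₂ : 0 < β₂) (hA : 0 < A)
    (ψ₁ ψ₂ : ℝ → ℝ)
    (hmono₁ : MonotoneOn (fun t : ℝ => ψ₁ t / t ^ 4) (Set.Ioi 0))
    (hmono₂ : MonotoneOn (fun t : ℝ => ψ₂ t / t ^ 4) (Set.Ioi 0))
    (h₁ : ψ₁ 1 < α₁ + β₁ + A) (h₂ : ψ₂ 1 < α₂ + β₂ + A)
    (t s : ℝ) (ht : 0 < t) (hs : 0 < s)
    (heq₁ : t ^ 2 * α₁ + t ^ 4 * β₁ + t ^ 2 * s ^ 2 * A = ψ₁ t)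
    (heq₂ : s ^ 2 * α₂ + s ^ 4 * β₂ + t ^ 2 * s ^ 2 * A = ψ₂ s) :
    1 < t ∧ 1 < s := by
  rcases le_total t s with hts | hst
  · have := stmt_8_aux α₁ β₁ A hα₁ hA ψ₁ hmono₁ h₁ t s ht hts heq₁
    exact ⟨this, by linarith⟩
  · have := stmt_8_aux α₂ β₂ A hα₂ hA ψ₂ hmono₂ h₂ s t hs hst (by linarith)
    exact ⟨by linarith, this⟩
end

section
/- Let α₁, α₂, β₁, β₂, A > 0 and let ψ₁, ψ₂ : (0, ∞) → ℝ be functions such that t ↦ ψᵢ(t)/t⁴ is nondecreasing on (0, ∞) for i = 1, 2. Suppose ψ₁(1) ≥ α₁ + β₁ + A and ψ₂(1) ≥ α₂ + β₂ + A. If (t, s) ∈ (0, ∞) × (0, ∞) satisfies t²α₁ + t⁴β₁ + t²s²A = ψ₁(t) and s²α₂ + s⁴β₂ + t²s²A = ψ₂(s), then t ≤ 1 and s ≤ 1. -/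
/-- The larger of the two coordinates is at most one. -/
lemma larger_le_one (α β A : ℝ) (hα : 0 < α) (hA : 0 < A) (ψ : ℝ → ℝ)
    (hmono : MonotoneOn (fun t : ℝ => ψ t / t ^ 4) (Set.Ioi 0))
    (h : α + β + A ≤ ψ 1) (t s : ℝ) (ht : 0 < t) (hs : 0 < s) (hst : s ≤ t)
    (heq : t ^ 2 * α + t ^ 4 * β + t ^ 2 * s ^ 2 * A = ψ t) : t ≤ 1 := by
  by_contra hc
  have h1 : 1 < t := not_le.mp hc
  have hm : ψ 1 / 1 ^ 4 ≤ ψ t / t ^ 4 :=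
    hmono (Set.mem_Ioi.mpr one_pos) (Set.mem_Ioi.mpr ht) h1.le
  have h4 : 0 < t ^ 4 := by positivity
  rw [one_pow, div_one, le_div_iff₀ h4, ← heq] at hm
  have h5 : (α + β + A) * t ^ 4 ≤ ψ 1 * t ^ 4 := mul_le_mul_of_nonneg_right h h4.le
  have h6 : s ^ 2 ≤ t ^ 2 := pow_le_pow_left₀ hs.le hst 2
  have h7 : t ^ 2 * s ^ 2 * A ≤ t ^ 2 * t ^ 2 * A := by gcongr
  have h8 : t ^ 2 < t ^ 4 := pow_lt_pow_right₀ h1 (by norm_num)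
  have h9 : t ^ 2 * α < t ^ 4 * α := mul_lt_mul_of_pos_right h8 hα
  linarith [show t ^ 2 * t ^ 2 * A = t ^ 4 * A by ring]

/-- Remark 2.6 / Step 1: if `ψᵢ(1) ≥ αᵢ + βᵢ + A` and each `ψᵢ(t)/t⁴` is nondecreasing on
`(0,∞)`, then any positive solution `(t, s)` of the system (2.3) satisfies `t ≤ 1`, `s ≤ 1`. -/
theorem stmt_9 (α₁ α₂ β₁ β₂ A : ℝ)
    (hα₁ : 0 < α₁) (hα₂ : 0 < α₂) (hβ₁ : 0 < β₁) (hβ₂ : 0 < β₂) (hA : 0 < A)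
    (ψ₁ ψ₂ : ℝ → ℝ)
    (hmono₁ : MonotoneOn (fun t : ℝ => ψ₁ t / t ^ 4) (Set.Ioi 0))
    (hmono₂ : MonotoneOn (fun t : ℝ => ψ₂ t / t ^ 4) (Set.Ioi 0))
    (h₁ : α₁ + β₁ + A ≤ ψ₁ 1) (h₂ : α₂ + β₂ + A ≤ ψ₂ 1)
    (t s : ℝ) (ht : 0 < t) (hs : 0 < s)
    (heq₁ : t ^ 2 * α₁ + t ^ 4 * β₁ + t ^ 2 * s ^ 2 * A = ψ₁ t)
    (heq₂ : s ^ 2 * α₂ + s ^ 4 * β₂ + t ^ 2 * s ^ 2 * A = ψ₂ s) :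
    t ≤ 1 ∧ s ≤ 1 := by
  have heq₂' : s ^ 2 * α₂ + s ^ 4 * β₂ + s ^ 2 * t ^ 2 * A = ψ₂ s := by
    rw [← heq₂]; ring
  rcases le_total s t with hst | hst
  · have := larger_le_one α₁ β₁ A hα₁ hA ψ₁ hmono₁ h₁ t s ht hs hst heq₁
    exact ⟨this, hst.trans this⟩
  · have := larger_le_one α₂ β₂ A hα₂ hA ψ₂ hmono₂ h₂ s t hs ht hst heq₂'
    exact ⟨hst.trans this, this⟩
end

section
/- Let α, β > 0 and let ψ : (0, ∞) → ℝ be continuous such that t ↦ ψ(t)/t⁴ is nondecreasing on (0, ∞) and ψ(1) > α + β. Then there exists a unique k > 0 satisfying k²α + k⁴β = ψ(k), and this k satisfies 0 < k < 1. -/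
/-- Step 2 of Theorem 1.1: one-dimensional Nehari projection. If `ψ(t)/t⁴` is nondecreasing
on `(0,∞)`, `ψ` is continuous on `(0,∞)`, and `ψ(1) > α + β`, then there is a unique `k > 0`
with `k²α + k⁴β = ψ(k)`, and it satisfies `k < 1`. -/
theorem stmt_10 (α β : ℝ) (hα : 0 < α) (hβ : 0 < β)
    (ψ : ℝ → ℝ) (hψ : ContinuousOn ψ (Set.Ioi 0))
    (hmono : MonotoneOn (fun t : ℝ => ψ t / t ^ 4) (Set.Ioi 0))
    (h1 : α + β < ψ 1) :
    ∃ k : ℝ, (0 < k ∧ k < 1 ∧ k ^ 2 * α + k ^ 4 * β = ψ k) ∧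
      ∀ k' : ℝ, 0 < k' → k' ^ 2 * α + k' ^ 4 * β = ψ k' → k' = k := by
  have hP : 0 < ψ 1 := by linarith
  have key : ∀ a b : ℝ, 0 < a → a < b → a ^ 2 * α + a ^ 4 * β = ψ a →
      b ^ 2 * α + b ^ 4 * β = ψ b → False := by
    intro a b ha hab h2 h3
    have hb : 0 < b := ha.trans hab
    have h := hmono (Set.mem_Ioi.2 ha) (Set.mem_Ioi.2 hb) hab.le
    simp only [← h2, ← h3] at h
    have e : ∀ x : ℝ, 0 < x → (x ^ 2 * α + x ^ 4 * β) / x ^ 4 = α / x ^ 2 + β := by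
      intro x hx
      field_simp
    rw [e a ha, e b hb] at h
    have : α / b ^ 2 < α / a ^ 2 := by gcongr
    linarith
  obtain ⟨ε, hε, hε2⟩ : ∃ ε : ℝ, 0 < ε ∧ ε ^ 2 = α / ψ 1 :=
    ⟨Real.sqrt (α / ψ 1), Real.sqrt_pos.2 (div_pos hα hP), Real.sq_sqrt (div_pos hα hP).le⟩
  have hαε : α = ε ^ 2 * ψ 1 := by rw [hε2]; field_simp
  have hε1 : ε < 1 := by
    by_contra hc
    have : 1 ≤ ε ^ 2 := one_le_pow₀ (not_lt.1 hc)
    nlinarith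
  have hle : ψ ε ≤ ψ 1 * ε ^ 4 := by
    have h := hmono (Set.mem_Ioi.2 hε) (Set.mem_Ioi.2 one_pos) hε1.le
    simp only [one_pow, div_one] at h
    rwa [div_le_iff₀ (by positivity)] at h
  have hneg : ψ ε - (ε ^ 2 * α + ε ^ 4 * β) < 0 := by
    have h4 : 0 < ε ^ 4 * β := by positivity
    have h5 : ε ^ 2 * α = ψ 1 * ε ^ 4 := by rw [hαε]; ring
    linarith
  have hcont : ContinuousOn (fun t : ℝ => ψ t - (t ^ 2 * α + t ^ 4 * β)) (Set.Icc ε 1) :=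
    (hψ.mono fun x hx => Set.mem_Ioi.2 (hε.trans_le hx.1)).sub (by fun_prop)
  obtain ⟨k, hk, hk0⟩ := intermediate_value_Ioo hε1.le hcont
    (show (0 : ℝ) ∈ Set.Ioo _ _ from ⟨hneg, by norm_num; linarith⟩)
  have hkp : 0 < k := hε.trans hk.1
  have hke : k ^ 2 * α + k ^ 4 * β = ψ k := by
    simp only at hk0
    linarith
  refine ⟨k, ⟨hkp, hk.2, hke⟩, fun k' hk' he => ?_⟩
  rcases lt_trichotomy k' k with h | h | h
  · exact (key _ _ hk' h he hke).elim
  · exact h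
  · exact (key _ _ hkp h hke he).elim
end

section
/- Let p > 2 be a real number and let A₁, A₂, B₁, B₂, B > 0 satisfy B² < B₁B₂. Then there exists a unique pair (t, s) ∈ (0, ∞) × (0, ∞) satisfying A₁t² = B₁t^{2p} + B·t^p s^p and A₂s² = B₂s^{2p} + B·s^p t^p. -/
lemma aux_key (B₁ B₂ B : ℝ) (hB₁ : 0 < B₁) (hCS : B ^ 2 < B₁ * B₂) (x y : ℝ)
    (h1 : (B₁ * x + B * y) * x ≤ 0) (h2 : (B₂ * y + B * x) * y ≤ 0) : x = 0 ∧ y = 0 := by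
  have hy : y = 0 := by
    by_contra hne
    have hy2 : 0 < y ^ 2 := by positivity
    have h4 : 0 < (B₁ * B₂ - B ^ 2) * y ^ 2 := mul_pos (by linarith) hy2
    have h3 : B₁ * ((B₁ * x + B * y) * x + (B₂ * y + B * x) * y) ≤ 0 :=
      mul_nonpos_of_nonneg_of_nonpos hB₁.le (by linarith)
    have h5 : B₁ * ((B₁ * x + B * y) * x + (B₂ * y + B * x) * y)
      = (B₁ * x + B * y) ^ 2 + (B₁ * B₂ - B ^ 2) * y ^ 2 := by ring
    linarith [sq_nonneg (B₁ * x + B * y)]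
  refine ⟨?_, hy⟩
  subst hy
  by_contra hne
  have hx2 : 0 < x ^ 2 := by positivity
  have h6 : (B₁ * x + B * 0) * x = B₁ * x ^ 2 := by ring
  linarith [mul_pos hB₁ hx2]

lemma aux_mono (p : ℝ) (hp : 2 < p) (a b : ℝ) (ha : 0 < a) (hb : 0 < b) :
    (a ^ (2 - p) - b ^ (2 - p)) * (a ^ p - b ^ p) ≤ 0 := by
  rcases le_total a b with h | h
  · have h1 : a ^ p ≤ b ^ p := Real.rpow_le_rpow ha.le h (by linarith)
    have h2 : b ^ (2 - p) ≤ a ^ (2 - p) := Real.rpow_le_rpow_of_nonpos ha h (by linarith)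
    nlinarith
  · have h1 : b ^ p ≤ a ^ p := Real.rpow_le_rpow hb.le h (by linarith)
    have h2 : a ^ (2 - p) ≤ b ^ (2 - p) := Real.rpow_le_rpow_of_nonpos hb h (by linarith)
    nlinarith

lemma aux_red (p A C B t y : ℝ) (ht : 0 < t)
    (h : A * t ^ 2 = C * t ^ (2 * p) + B * t ^ p * y) :
    A * t ^ (2 - p) = C * t ^ p + B * y := by
  have hx : 0 < t ^ p := Real.rpow_pos_of_pos ht p
  have e1 : t ^ (2 * p) = t ^ p * t ^ p := by rw [← Real.rpow_add ht]; ring_nf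
  have e2 : t ^ 2 = t ^ (2 - p) * t ^ p := by
    rw [← Real.rpow_add ht, ← Real.rpow_natCast]; norm_num
  rw [e1, e2] at h
  apply mul_right_cancel₀ hx.ne'
  linarith

lemma aux_exists (p A₁ A₂ B₁ B₂ B : ℝ) (hp : 2 < p)
    (hA₁ : 0 < A₁) (hA₂ : 0 < A₂) (hB₁ : 0 < B₁) (hB₂ : 0 < B₂) (hB : 0 < B) :
    ∃ c : ℝ, 0 < c ∧
      A₁ * (B₂ * c ^ (2 * p) + B * c ^ p) = A₂ * c ^ 2 * (B₁ + B * c ^ p) := by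
  let g : ℝ → ℝ := fun c =>
    A₁ * (B₂ * (c ^ p * c ^ (p - 2)) + B * c ^ (p - 2)) - A₂ * (B₁ + B * c ^ p)
  have c1 : Continuous fun c : ℝ => c ^ p := Real.continuous_rpow_const (by linarith)
  have c2 : Continuous fun c : ℝ => c ^ (p - 2) := Real.continuous_rpow_const (by linarith)
  have hg : Continuous g := by fun_prop
  have g0 : g 0 < 0 := by
    simp only [g, Real.zero_rpow (show p ≠ 0 by linarith),
      Real.zero_rpow (show p - 2 ≠ 0 by linarith)]
    nlinarith [mul_pos hA₂ hB₁]
  set K : ℝ := A₂ * (B₁ + B) / (A₁ * B₂) with hK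
  have hK0 : 0 < K := by positivity
  set d : ℝ := (K + 1) ^ (1 / (p - 2)) with hd
  have hd1 : 1 ≤ d := Real.one_le_rpow (by linarith) (by
    have : 0 < p - 2 := by linarith
    positivity)
  have hdp : d ^ (p - 2) = K + 1 := by
    rw [hd, ← Real.rpow_mul (by linarith), one_div_mul_cancel (by linarith), Real.rpow_one]
  have hd2 : 1 ≤ d ^ p := Real.one_le_rpow hd1 (by linarith)
  have gd : 0 < g d := by
    simp only [g, hdp]
    have e : A₁ * B₂ * K = A₂ * (B₁ + B) := by rw [hK]; field_simp
    have e2 : A₁ * (B₂ * (d ^ p * (K + 1)) + B * (K + 1)) - A₂ * (B₁ + B * d ^ p)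
      = (A₁ * B₂ * K) * d ^ p + A₁ * B₂ * d ^ p + A₁ * B * (K + 1)
        - A₂ * (B₁ + B * d ^ p) := by ring
    rw [e2, e]
    have : 0 < A₁ * B₂ * d ^ p := by positivity
    have : 0 < A₁ * B * (K + 1) := by positivity
    nlinarith [mul_nonneg (mul_pos hA₂ hB₁).le (sub_nonneg.2 hd2)]
  obtain ⟨c, hc, hgc⟩ := intermediate_value_Icc (show (0 : ℝ) ≤ d by linarith)
    hg.continuousOn ⟨g0.le, gd.le⟩
  have hcpos : 0 < c := by
    rcases hc.1.eq_or_lt with h | h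
    · rw [← h] at hgc; linarith
    · exact h
  refine ⟨c, hcpos, ?_⟩
  have e1 : c ^ (2 * p) = c ^ p * c ^ p := by rw [← Real.rpow_add hcpos]; ring_nf
  have e2 : c ^ p = c ^ (p - 2) * c ^ 2 := by
    rw [← Real.rpow_natCast, ← Real.rpow_add hcpos]; norm_num
  simp only [g] at hgc
  rw [e1]
  have : A₁ * (B₂ * (c ^ p * c ^ p) + B * c ^ p)
    = A₁ * (B₂ * (c ^ p * (c ^ (p - 2) * c ^ 2)) + B * (c ^ (p - 2) * c ^ 2)) := by
    rw [← e2]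
  rw [this]
  linear_combination c ^ 2 * hgc

/-- Lemma 3.2 (case `p > 2`): the Nehari-type system (3.3) of the Choquard equation has a
unique positive solution `(t, s)`. -/
theorem stmt_11 (p A₁ A₂ B₁ B₂ B : ℝ) (hp : 2 < p)
    (hA₁ : 0 < A₁) (hA₂ : 0 < A₂) (hB₁ : 0 < B₁) (hB₂ : 0 < B₂) (hB : 0 < B)
    (hCS : B ^ 2 < B₁ * B₂) :
    ∃ t s : ℝ, (0 < t ∧ 0 < s ∧
        A₁ * t ^ 2 = B₁ * t ^ (2 * p) + B * t ^ p * s ^ p ∧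
        A₂ * s ^ 2 = B₂ * s ^ (2 * p) + B * s ^ p * t ^ p) ∧
      ∀ t' s' : ℝ, 0 < t' → 0 < s' →
        A₁ * t' ^ 2 = B₁ * t' ^ (2 * p) + B * t' ^ p * s' ^ p →
        A₂ * s' ^ 2 = B₂ * s' ^ (2 * p) + B * s' ^ p * t' ^ p →
        t' = t ∧ s' = s := by
  obtain ⟨c, hc, hce⟩ := aux_exists p A₁ A₂ B₁ B₂ B hp hA₁ hA₂ hB₁ hB₂ hB
  have hcp : 0 < c ^ p := Real.rpow_pos_of_pos hc p
  have hD : 0 < B₁ + B * c ^ p := by positivity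
  set D : ℝ := B₁ + B * c ^ p with hDdef
  obtain ⟨t, ht, hte⟩ : ∃ t : ℝ, 0 < t ∧ A₁ * t ^ 2 = D * t ^ (2 * p) := by
    have hq : 0 < A₁ / D := by positivity
    refine ⟨(A₁ / D) ^ (1 / (2 * p - 2)), Real.rpow_pos_of_pos hq _, ?_⟩
    set t : ℝ := (A₁ / D) ^ (1 / (2 * p - 2)) with htd
    have ht : 0 < t := Real.rpow_pos_of_pos hq _
    have e1 : t ^ (2 * p - 2) = A₁ / D := by
      rw [htd, ← Real.rpow_mul hq.le, one_div_mul_cancel (by linarith), Real.rpow_one]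
    have e2 : t ^ (2 * p) = t ^ (2 * p - 2) * t ^ 2 := by
      rw [← Real.rpow_natCast, ← Real.rpow_add ht]; norm_num
    rw [e2, e1]; field_simp
  have hs : 0 < c * t := mul_pos hc ht
  have f1 : (c * t) ^ p = c ^ p * t ^ p := Real.mul_rpow hc.le ht.le
  have f2 : (c * t) ^ (2 * p) = c ^ (2 * p) * t ^ (2 * p) := Real.mul_rpow hc.le ht.le
  have f3 : t ^ (2 * p) = t ^ p * t ^ p := by rw [← Real.rpow_add ht]; ring_nf
  have E1 : A₁ * t ^ 2 = B₁ * t ^ (2 * p) + B * t ^ p * (c * t) ^ p := by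
    rw [hte, f1, f3, hDdef]; ring
  have E2 : A₂ * (c * t) ^ 2 = B₂ * (c * t) ^ (2 * p) + B * (c * t) ^ p * t ^ p := by
    rw [f1, f2]
    apply mul_left_cancel₀ hA₁.ne'
    have : A₁ * (B₂ * (c ^ (2 * p) * t ^ (2 * p)) + B * (c ^ p * t ^ p) * t ^ p)
      = A₁ * (B₂ * c ^ (2 * p) + B * c ^ p) * t ^ (2 * p) := by rw [f3]; ring
    rw [this, hce]
    linear_combination A₂ * c ^ 2 * hte
  refine ⟨t, c * t, ⟨ht, hs, E1, E2⟩, ?_⟩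
  generalize c * t = s at hs E1 E2
  intro t' s' ht' hs' E1' E2'
  have r1 := aux_red _ _ _ _ _ _ ht E1
  have r2 := aux_red _ _ _ _ _ _ hs E2
  have r1' := aux_red _ _ _ _ _ _ ht' E1'
  have r2' := aux_red _ _ _ _ _ _ hs' E2'
  have m1 := mul_nonpos_of_nonneg_of_nonpos hA₁.le (aux_mono p hp t' t ht' ht)
  have m2 := mul_nonpos_of_nonneg_of_nonpos hA₂.le (aux_mono p hp s' s hs' hs)
  have k1 : A₁ * ((t' ^ (2 - p) - t ^ (2 - p)) * (t' ^ p - t ^ p))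
      = (B₁ * (t' ^ p - t ^ p) + B * (s' ^ p - s ^ p)) * (t' ^ p - t ^ p) := by
    linear_combination (t' ^ p - t ^ p) * (r1' - r1)
  have k2 : A₂ * ((s' ^ (2 - p) - s ^ (2 - p)) * (s' ^ p - s ^ p))
      = (B₂ * (s' ^ p - s ^ p) + B * (t' ^ p - t ^ p)) * (s' ^ p - s ^ p) := by
    linear_combination (s' ^ p - s ^ p) * (r2' - r2)
  rw [k1] at m1
  rw [k2] at m2
  obtain ⟨hx, hy⟩ := aux_key B₁ B₂ B hB₁ hCS _ _ m1 m2
  have hp0 : p ≠ 0 := by linarith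
  exact ⟨(Real.rpow_left_inj ht'.le ht.le hp0).1 (sub_eq_zero.1 hx),
    (Real.rpow_left_inj hs'.le hs.le hp0).1 (sub_eq_zero.1 hy)⟩
end

section
/- Let p > 2 be a real number and let A₁, A₂, B₁, B₂, B > 0 satisfy B² < B₁B₂. Set T = (A₁/B₁)^{1/(2p−2)} and define, for 0 < t < T, h(t) = A₂·(A₁/(B·t^{2p−2}) − B₁/B)^{(2−p)/p} − ((B² − B₁B₂)/B)·t^{2p−2} − B₂A₁/B. Then h is strictly increasing on (0, T), h(t) → −B₂A₁/B as t → 0⁺, and h(t) → +∞ as t → T⁻; consequently h has a unique zero t₀ ∈ (0, T). -/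
/-- Properties of the auxiliary function `h` in the proof of Lemma 3.2: `h` is strictly
increasing on `(0, T)`, `h(t) → −B₂A₁/B` as `t → 0⁺`, `h(t) → +∞` as `t → T⁻`, and `h`
has a unique zero in `(0, T)`. -/
theorem stmt_12 (p A₁ A₂ B₁ B₂ B : ℝ) (hp : 2 < p)
    (hA₁ : 0 < A₁) (hA₂ : 0 < A₂) (hB₁ : 0 < B₁) (hB₂ : 0 < B₂) (hB : 0 < B)
    (hCS : B ^ 2 < B₁ * B₂)
    (T : ℝ) (hT : T = (A₁ / B₁) ^ (1 / (2 * p - 2)))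
    (h : ℝ → ℝ)
    (hh : ∀ t : ℝ, h t =
      A₂ * (A₁ / (B * t ^ (2 * p - 2)) - B₁ / B) ^ ((2 - p) / p)
        - ((B ^ 2 - B₁ * B₂) / B) * t ^ (2 * p - 2) - B₂ * A₁ / B) :
    StrictMonoOn h (Set.Ioo 0 T) ∧
    Filter.Tendsto h (nhdsWithin 0 (Set.Ioi 0)) (nhds (-(B₂ * A₁ / B))) ∧
    Filter.Tendsto h (nhdsWithin T (Set.Iio T)) Filter.atTop ∧
    ∃! t₀ : ℝ, t₀ ∈ Set.Ioo 0 T ∧ h t₀ = 0 := by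
  have hq : 0 < 2 * p - 2 := by linarith
  have he : (2 - p) / p < 0 := div_neg_of_neg_of_pos (by linarith) (by linarith)
  have hc : (B ^ 2 - B₁ * B₂) / B < 0 := div_neg_of_neg_of_pos (by linarith) hB
  have hAB : 0 < A₁ / B₁ := div_pos hA₁ hB₁
  have hTpos : 0 < T := by rw [hT]; positivity
  have hTq : T ^ (2 * p - 2) = A₁ / B₁ := by
    rw [hT, ← Real.rpow_mul hAB.le, one_div_mul_cancel hq.ne', Real.rpow_one]
  have hTlim : A₁ / (B * T ^ (2 * p - 2)) - B₁ / B = 0 := by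
    rw [hTq]; field_simp; ring
  generalize 2 * p - 2 = q at *
  generalize (2 - p) / p = e at *
  generalize (B ^ 2 - B₁ * B₂) / B = c at *
  have hanti : ∀ s t : ℝ, 0 < s → s < t →
      A₁ / (B * t ^ q) - B₁ / B < A₁ / (B * s ^ q) - B₁ / B := by
    intro s t hs hst
    have h1 : s ^ q < t ^ q := Real.rpow_lt_rpow hs.le hst hq
    have h2 : 0 < s ^ q := Real.rpow_pos_of_pos hs q
    gcongr
  have hpos : ∀ t ∈ Set.Ioo 0 T, 0 < A₁ / (B * t ^ q) - B₁ / B := by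
    intro t ht
    have := hanti t T ht.1 ht.2
    linarith
  have hmono : StrictMonoOn h (Set.Ioo 0 T) := by
    intro s hs t ht hst
    rw [hh s, hh t]
    have h1 : s ^ q < t ^ q := Real.rpow_lt_rpow hs.1.le hst hq
    have h3 := Real.rpow_lt_rpow_of_neg (hpos t ht) (hanti s t hs.1 hst) he
    have h4 := mul_lt_mul_of_pos_left h3 hA₂
    have h5 := mul_lt_mul_of_neg_left h1 hc
    linarith
  have hcq : Continuous fun t : ℝ => t ^ q := Real.continuous_rpow_const hq.le
  have hlim0 : Filter.Tendsto h (nhdsWithin 0 (Set.Ioi 0)) (nhds (-(B₂ * A₁ / B))) := by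
    have a0 : Filter.Tendsto (fun t : ℝ => t ^ q) (nhdsWithin 0 (Set.Ioi 0)) (nhds 0) := by
      have := (hcq.tendsto 0).mono_left (nhdsWithin_le_nhds (s := Set.Ioi 0))
      rwa [Real.zero_rpow hq.ne'] at this
    have a1 : Filter.Tendsto (fun t : ℝ => B * t ^ q) (nhdsWithin 0 (Set.Ioi 0))
        (nhdsWithin 0 (Set.Ioi 0)) := by
      apply tendsto_nhdsWithin_of_tendsto_nhds_of_eventually_within
      · simpa using a0.const_mul B
      · filter_upwards [self_mem_nhdsWithin] with t ht
        exact mul_pos hB (Real.rpow_pos_of_pos ht q)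
    have a2 : Filter.Tendsto (fun t : ℝ => A₁ / (B * t ^ q) - B₁ / B)
        (nhdsWithin 0 (Set.Ioi 0)) Filter.atTop := by
      have := (tendsto_inv_nhdsGT_zero.comp a1).const_mul_atTop hA₁
      exact Filter.tendsto_atTop_add_const_right _ (-(B₁ / B)) this
    have a3 := (tendsto_rpow_neg_atTop (neg_pos.2 he)).comp a2
    have a4 := ((a3.const_mul A₂).sub (a0.const_mul c)).sub_const (B₂ * A₁ / B)
    rw [show h = _ from funext hh]
    simpa [Function.comp_def] using a4
  have hlimT : Filter.Tendsto h (nhdsWithin T (Set.Iio T)) Filter.atTop := by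
    have hI : Set.Ioo 0 T ∈ nhdsWithin T (Set.Iio T) := Ioo_mem_nhdsLT hTpos
    have a0 : Filter.Tendsto (fun t : ℝ => t ^ q) (nhdsWithin T (Set.Iio T)) (nhds (T ^ q)) :=
      (hcq.tendsto T).mono_left nhdsWithin_le_nhds
    have a1 : Filter.Tendsto (fun t : ℝ => A₁ / (B * t ^ q) - B₁ / B)
        (nhdsWithin T (Set.Iio T)) (nhdsWithin 0 (Set.Ioi 0)) := by
      apply tendsto_nhdsWithin_of_tendsto_nhds_of_eventually_within
      · rw [← hTlim]
        refine (Filter.Tendsto.div tendsto_const_nhds (a0.const_mul B) ?_).sub_const _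
        rw [hTq]; positivity
      · filter_upwards [hI] with t ht using hpos t ht
    have a3 := ((tendsto_rpow_neg_nhdsGT_zero he).comp a1).const_mul_atTop hA₂
    have a4 := a3.atTop_add (((a0.const_mul c).neg).sub_const (B₂ * A₁ / B))
    rw [show h = _ from funext hh]
    refine a4.congr fun t => ?_
    simp only [Function.comp_def]; ring
  refine ⟨hmono, hlim0, hlimT, ?_⟩
  have hcont : ContinuousOn h (Set.Ioo 0 T) := by
    rw [show h = _ from funext hh]
    intro t ht
    have h2 : 0 < t ^ q := Real.rpow_pos_of_pos ht.1 q
    apply ContinuousAt.continuousWithinAt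
    refine ContinuousAt.sub (ContinuousAt.sub (ContinuousAt.mul continuousAt_const ?_)
      (hcq.continuousAt.const_mul c)) continuousAt_const
    refine ContinuousAt.rpow_const ?_ (Or.inl (hpos t ht).ne')
    exact (continuousAt_const.div (hcq.continuousAt.const_mul B) (by positivity)).sub
      continuousAt_const
  have hneg : -(B₂ * A₁ / B) < 0 := neg_lt_zero.2 (by positivity)
  obtain ⟨a, ha, haI⟩ := ((hlim0.eventually (gt_mem_nhds hneg)).and
    (Ioo_mem_nhdsGT hTpos)).exists
  obtain ⟨b, hb, hbI⟩ := ((hlimT.eventually (Filter.eventually_gt_atTop 0)).and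
    (Ioo_mem_nhdsLT hTpos)).exists
  obtain ⟨t, ht, ht0⟩ := isPreconnected_Ioo.intermediate_value haI hbI hcont
    (show (0 : ℝ) ∈ Set.Icc (h a) (h b) from ⟨le_of_lt ha, le_of_lt hb⟩)
  exact ⟨t, ⟨ht, ht0⟩, fun y hy => hmono.injOn hy.1 ht (hy.2.trans ht0.symm)⟩
end
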